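/- Let N ≥ 1, c₀ ∈ ℝ^N, and β̄ ∈ ℝ^{2N−1} componentwise nonnegative such that Z = Z(G^{PE},c₀,β̄) is full-dimensional. Let F be a facet of Z with normal vector c ∈ ℝ^N, let l be an index maximizing |c_l| with c_l > 0, and let j ≤ l ≤ k be the maximal block of consecutive indices with c_i = c_l for all j ≤ i ≤ k. Set I₁ := {j,…,k} and I₂ := {1,…,N} ∖ I₁. Then F decomposes as a product along this coordinate partition: F = {z ∈ ℝ^N : the restriction of z to the coordinates I₁ lies in the projection F|_{I₁} of F onto ℝ^{I₁}, and the restriction of z to the coordinates I₂ lies in the projection F|_{I₂} of F onto ℝ^{I₂}}. -/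

import Mathlib

open Matrix Finset

noncomputable section

/-- The zonotope `Z(G, c, β̄) = {c + Gβ : -β̄ ≤ β ≤ β̄}`. -/
def zonotope {N : ℕ} {ι : Type*} [Fintype ι] (G : Matrix (Fin N) ι ℝ) (c : Fin N → ℝ)
    (βb : ι → ℝ) : Set (Fin N → ℝ) :=
  {z | ∃ β : ι → ℝ, (∀ i, -βb i ≤ β i ∧ β i ≤ βb i) ∧ z = c + G.mulVec β}

/-- The PE generator matrix `G^{PE} ∈ ℝ^{N×(2N-1)}`: its first `N` columns (indexed by
`Sum.inl`) are the standard basis vectors `e_i`, and its last `N-1` columns (indexed by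
`Sum.inr j`, 0-indexed) are `(e_{j+1} - e_j)/√2`. -/
def GPE (N : ℕ) : Matrix (Fin N) (Fin N ⊕ Fin (N - 1)) ℝ :=
  Matrix.of fun n i =>
    match i with
    | Sum.inl m => if n = m then 1 else 0
    | Sum.inr j =>
        (if (n : ℕ) = (j : ℕ) + 1 then 1 else if (n : ℕ) = (j : ℕ) then -1 else 0) /
          Real.sqrt 2

/-- `F` is the exposed face of `Z` in the direction of the (nonzero) normal vector `v`,
i.e. the set of points of `Z` maximizing `z ↦ ⟨v, z⟩` over `Z`. -/
def IsExposedFaceWithNormal {N : ℕ} (Z F : Set (Fin N → ℝ)) (v : Fin N → ℝ) : Prop :=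
  v ≠ 0 ∧ F = {z ∈ Z | ∀ z' ∈ Z, v ⬝ᵥ z' ≤ v ⬝ᵥ z}

/-- `F` is a facet of `Z`: an exposed face whose affine span has dimension `N - 1`. -/
def IsFacet {N : ℕ} (Z F : Set (Fin N → ℝ)) : Prop :=
  (∃ v, IsExposedFaceWithNormal Z F v) ∧
    Module.finrank ℝ (affineSpan ℝ F).direction = N - 1

lemma dotProduct_add_mulVec {N : ℕ} {ι : Type*} [Fintype ι] (G : Matrix (Fin N) ι ℝ)
    (c c₀ : Fin N → ℝ) (β : ι → ℝ) :
    c ⬝ᵥ (c₀ + G *ᵥ β) = c ⬝ᵥ c₀ + ∑ i, (c ᵥ* G) i * β i := by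
  rw [dotProduct_add, dotProduct_mulVec]
  rfl

/-- The coefficient vectors of the points of a zonotope maximizing `⟨c, ·⟩` are those whose
entries saturate their bound along every generator that is not orthogonal to `c`. -/
lemma isMax_zonotope_iff {N : ℕ} {ι : Type*} [Fintype ι] (G : Matrix (Fin N) ι ℝ)
    (c c₀ : Fin N → ℝ) {βb β : ι → ℝ} (hβb : ∀ i, 0 ≤ βb i)
    (hβ : ∀ i, -βb i ≤ β i ∧ β i ≤ βb i) :
    (∀ z ∈ zonotope G c₀ βb, c ⬝ᵥ z ≤ c ⬝ᵥ (c₀ + G *ᵥ β)) ↔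
      ∀ i, (c ᵥ* G) i * β i = |(c ᵥ* G) i| * βb i := by
  have bound : ∀ γ : ι → ℝ, (∀ i, -βb i ≤ γ i ∧ γ i ≤ βb i) →
      ∀ i, (c ᵥ* G) i * γ i ≤ |(c ᵥ* G) i| * βb i := fun γ hγ i =>
    (le_abs_self _).trans <| by
      rw [abs_mul]
      exact mul_le_mul_of_nonneg_left (abs_le.2 (hγ i)) (abs_nonneg _)
  constructor
  · intro h
    have hmax := h (c₀ + G *ᵥ fun i => if 0 ≤ (c ᵥ* G) i then βb i else -βb i)
      ⟨_, fun i => by have := hβb i; split_ifs <;> constructor <;> linarith, rfl⟩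
    rw [dotProduct_add_mulVec, dotProduct_add_mulVec] at hmax
    have hsum : ∑ i, (c ᵥ* G) i * (if 0 ≤ (c ᵥ* G) i then βb i else -βb i) =
        ∑ i, |(c ᵥ* G) i| * βb i := by
      refine Finset.sum_congr rfl fun i _ => ?_
      split_ifs with hi
      · rw [abs_of_nonneg hi]
      · rw [abs_of_neg (not_le.1 hi)]; ring
    have heq := (Finset.sum_eq_sum_iff_of_le fun i _ => bound β hβ i).1
      (le_antisymm (Finset.sum_le_sum fun i _ => bound β hβ i) (by linarith))
    exact fun i => heq i (Finset.mem_univ i)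
  · rintro h z ⟨γ, hγ, rfl⟩
    rw [dotProduct_add_mulVec, dotProduct_add_mulVec, Finset.sum_congr rfl fun i _ => h i]
    have := Finset.sum_le_sum fun i (_ : i ∈ Finset.univ) => bound γ hγ i
    linarith

/-- A coordinate of `GPE N *ᵥ β` depends only on the coefficients of the generators supported
on that coordinate. -/
lemma GPE_mulVec_congr {N : ℕ} {n : Fin N} {β δ : Fin N ⊕ Fin (N - 1) → ℝ}
    (hl : β (Sum.inl n) = δ (Sum.inl n))
    (hr : ∀ m : Fin (N - 1), (n : ℕ) = m + 1 ∨ (n : ℕ) = m → β (Sum.inr m) = δ (Sum.inr m)) :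
    (GPE N *ᵥ β) n = (GPE N *ᵥ δ) n := by
  simp only [mulVec, dotProduct]
  refine Finset.sum_congr rfl fun i _ => ?_
  obtain m | m := i
  · by_cases h : n = m
    · subst h
      rw [hl]
    · simp [GPE, h]
  · by_cases h : (n : ℕ) = m + 1 ∨ (n : ℕ) = m
    · rw [hr m h]
    · push Not at h
      simp [GPE, h]

lemma vecMul_GPE_inr {N : ℕ} (c : Fin N → ℝ) (m : Fin (N - 1)) :
    (c ᵥ* GPE N) (Sum.inr m) =
      (c ⟨m + 1, by omega⟩ - c ⟨m, by omega⟩) / Real.sqrt 2 := by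
  have hcol : ∀ n : Fin N, c n * GPE N n (Sum.inr m) =
      ((if n = ⟨m + 1, by omega⟩ then c n else 0) - (if n = ⟨m, by omega⟩ then c n else 0)) /
        Real.sqrt 2 := by
    intro n
    simp only [GPE, Matrix.of_apply, Fin.ext_iff]
    split_ifs <;> first | omega | ring
  simp only [vecMul, dotProduct, hcol]
  rw [← Finset.sum_div, Finset.sum_sub_distrib]
  simp

/-- A facet `F` of a full-dimensional PE-zonotope, with normal vector `c`, maximal-block
indices `j ≤ l ≤ k` (0-indexed) as in Claim 1, decomposes as a product along the coordinate
partition `I₁ = {j, …, k}`, `I₂ = {0, …, N-1} \ I₁`: a point `z` lies in `F` iff its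
restriction to `I₁` lies in the projection `F|_{I₁}` and its restriction to `I₂` lies in the
projection `F|_{I₂}`. -/
theorem facet_product_decomposition {N : ℕ} (hN : 1 ≤ N) (c₀ : Fin N → ℝ)
    (βb : Fin N ⊕ Fin (N - 1) → ℝ) (hβb : ∀ i, 0 ≤ βb i)
    (hfull : affineSpan ℝ (zonotope (GPE N) c₀ βb) = ⊤)
    (F : Set (Fin N → ℝ)) (c : Fin N → ℝ)
    (hface : IsExposedFaceWithNormal (zonotope (GPE N) c₀ βb) F c)
    (hdim : Module.finrank ℝ (affineSpan ℝ F).direction = N - 1)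
    (l : Fin N) (hl : ∀ i, |c i| ≤ c l) (hlpos : 0 < c l)
    (j k : ℕ) (hjl : j ≤ (l : ℕ)) (hlk : (l : ℕ) ≤ k) (hkN : k < N)
    (hblock : ∀ i : Fin N, j ≤ (i : ℕ) → (i : ℕ) ≤ k → c i = c l)
    (hjmax : ∀ hj : 0 < j, c ⟨j - 1, by omega⟩ ≠ c l)
    (hkmax : ∀ hk : k < N - 1, c ⟨k + 1, by omega⟩ ≠ c l) :
    F = {z : Fin N → ℝ |
          (∃ x ∈ F, ∀ i : Fin N, j ≤ (i : ℕ) ∧ (i : ℕ) ≤ k → z i = x i) ∧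
          (∃ y ∈ F, ∀ i : Fin N, ¬(j ≤ (i : ℕ) ∧ (i : ℕ) ≤ k) → z i = y i)} := by
  obtain ⟨-, rfl⟩ := hface
  ext z
  refine ⟨fun hz => ⟨⟨z, hz, fun _ _ => rfl⟩, ⟨z, hz, fun _ _ => rfl⟩⟩, ?_⟩
  rintro ⟨⟨x, ⟨⟨β, hβ, rfl⟩, hx⟩, hzx⟩, ⟨y, ⟨⟨γ, hγ, rfl⟩, hy⟩, hzy⟩⟩
  rw [isMax_zonotope_iff _ _ _ hβb hβ] at hx
  rw [isMax_zonotope_iff _ _ _ hβb hγ] at hy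
  have hcross : ∀ m : Fin (N - 1),
      ¬((j ≤ (m : ℕ) ∧ (m : ℕ) ≤ k) ↔ (j ≤ (m : ℕ) + 1 ∧ (m : ℕ) + 1 ≤ k)) →
      β (Sum.inr m) = γ (Sum.inr m) := by
    intro m hm
    have hne : (c ᵥ* GPE N) (Sum.inr m) ≠ 0 := by
      rw [vecMul_GPE_inr]
      refine div_ne_zero (sub_ne_zero.2 ?_) (by positivity)
      obtain h | h : (m : ℕ) + 1 = j ∨ (m : ℕ) = k := by omega
      · subst h
        rw [hblock ⟨m + 1, by omega⟩ le_rfl (hjl.trans hlk)]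
        exact (hjmax (Nat.succ_pos _)).symm
      · subst h
        rw [hblock ⟨m, by omega⟩ (hjl.trans hlk) le_rfl]
        exact hkmax m.2
    exact mul_left_cancel₀ hne ((hx _).trans (hy _).symm)
  let inBlock : Fin N ⊕ Fin (N - 1) → Prop :=
    Sum.elim (fun n => j ≤ (n : ℕ) ∧ (n : ℕ) ≤ k) (fun m => j ≤ (m : ℕ) ∧ (m : ℕ) ≤ k)
  classical
  let δ : Fin N ⊕ Fin (N - 1) → ℝ := fun i => if inBlock i then β i else γ i
  have hδ : ∀ i, -βb i ≤ δ i ∧ δ i ≤ βb i := fun i => by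
    simp only [δ]
    split_ifs
    exacts [hβ i, hγ i]
  have hzδ : z = c₀ + GPE N *ᵥ δ := by
    ext n
    by_cases hn : j ≤ (n : ℕ) ∧ (n : ℕ) ≤ k
    · rw [hzx n hn, Pi.add_apply, Pi.add_apply,
        GPE_mulVec_congr (δ := δ) (by simp [δ, inBlock, hn]) fun m h => ?_]
      by_cases hm : inBlock (Sum.inr m)
      · exact (if_pos hm).symm
      · refine (hcross m ?_).trans (if_neg hm).symm
        simp only [inBlock, Sum.elim_inr] at hm
        omega
    · rw [hzy n hn, Pi.add_apply, Pi.add_apply,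
        GPE_mulVec_congr (δ := δ) (by simp [δ, inBlock, hn]) fun m h => ?_]
      by_cases hm : inBlock (Sum.inr m)
      · refine (hcross m ?_).symm.trans (if_pos hm).symm
        simp only [inBlock, Sum.elim_inr] at hm
        omega
      · exact (if_neg hm).symm
  subst hzδ
  refine ⟨⟨δ, hδ, rfl⟩, (isMax_zonotope_iff _ _ _ hβb hδ).2 fun i => ?_⟩
  simp only [δ]
  split_ifs
  exacts [hx i, hy i]
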